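/- There exists τ* > 0 such that for every τ ∈ (0, τ*), every s ∈ ℂ, every unitary representation (ρ, V) of Γ on a finite-dimensional complex Hilbert space V, and every holomorphic function u : 𝐃 → V with ∫_𝐃 ‖u(z)‖²_V dm(z) < ∞ (m denoting Lebesgue measure on ℂ): if u(x) = Σ_{a ∈ 𝒜, a → b} (γ′_a(x))^s · ρ(γ_a⁻¹) u(γ_a(x)) for every b ∈ 𝒜 and every x ∈ D_b, then also u(x) = Σ_{𝐚 ∈ Z̄(τ), 𝐚 ⇝ b} (γ′_{𝐚′}(x))^s · ρ(γ_{𝐚′}⁻¹) u(γ_{𝐚′}(x)) for every b ∈ 𝒜 and every x ∈ D_b. -/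

import Mathlib

open MeasureTheory

/-- `SL(2,ℝ)`. -/
abbrev SL2 : Type := Matrix.SpecialLinearGroup (Fin 2) ℝ

/-- The Möbius transformation of `g ∈ SL(2,ℝ)` acting on `ℂ` (junk at the pole). -/
noncomputable def mobiusC (g : SL2) (z : ℂ) : ℂ :=
  ((g.1 0 0 : ℂ) * z + (g.1 0 1 : ℂ)) / ((g.1 1 0 : ℂ) * z + (g.1 1 1 : ℂ))

/-- The Möbius transformation of `g ∈ SL(2,ℝ)` acting on `ℝ` (junk at the pole). -/
noncomputable def mobiusR (g : SL2) (x : ℝ) : ℝ :=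
  (g.1 0 0 * x + g.1 0 1) / (g.1 1 0 * x + g.1 1 1)

/-- The derivative `γ'(z) = (uz+v)⁻²` of the Möbius transformation of `g`. -/
noncomputable def mobiusDerivC (g : SL2) (z : ℂ) : ℂ :=
  ((g.1 1 0 : ℂ) * z + (g.1 1 1 : ℂ))⁻¹ ^ 2

/-- The derivative `γ'(x) = (ux+v)⁻²` of the Möbius transformation of `g`, real version. -/
noncomputable def mobiusDerivR (g : SL2) (x : ℝ) : ℝ :=
  (g.1 1 0 * x + g.1 1 1)⁻¹ ^ 2

/-- The Möbius transformation of `g ∈ SL(2,ℝ)` acting on the Riemann sphere `ℂ ∪ {∞}`. -/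
noncomputable def mobiusS (g : SL2) (z : OnePoint ℂ) : OnePoint ℂ :=
  Option.elim z
    (if (g.1 1 0 : ℝ) = 0 then OnePoint.infty else (((g.1 0 0 / g.1 1 0 : ℝ) : ℂ) : OnePoint ℂ))
    (fun w => if ((g.1 1 0 : ℂ) * w + (g.1 1 1 : ℂ)) = 0 then OnePoint.infty
      else ((mobiusC g w : ℂ) : OnePoint ℂ))

/-- The involution `a ↦ ā = a + r mod 2r` on the alphabet `𝒜 = Fin (2r)`. -/
def wordBar {r : ℕ} (a : Fin (2 * r)) : Fin (2 * r) :=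
  ⟨(a.1 + r) % (2 * r), Nat.mod_lt _ (Nat.lt_of_le_of_lt (Nat.zero_le _) a.isLt)⟩

/-- A word: a finite sequence of letters with no adjacent letter equal to the bar of the
previous one. -/
def IsWord {r : ℕ} (w : List (Fin (2 * r))) : Prop :=
  w.Chain' (fun x y => x ≠ wordBar y)

/-- The mirror word `𝐚̄ = (ā_n, …, ā_1)`. -/
def mirror {r : ℕ} (w : List (Fin (2 * r))) : List (Fin (2 * r)) :=
  (w.map wordBar).reverse

/-- `𝐚 → 𝐛` : either word is empty, or the last letter of `𝐚` is not the bar of the first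
letter of `𝐛`. -/
def arrow {r : ℕ} (w v : List (Fin (2 * r))) : Prop :=
  ∀ x ∈ w.getLast?, ∀ y ∈ v.head?, x ≠ wordBar y

/-- `𝐚 ⇝ 𝐛` : both words are nonempty and the last letter of `𝐚` equals the first letter
of `𝐛`. -/
def wiggly {r : ℕ} (w v : List (Fin (2 * r))) : Prop :=
  w ≠ [] ∧ v ≠ [] ∧ w.getLast? = v.head?

/-- Schottky data: pairwise disjoint closed discs centered on the real line, paired by
elements of `SL(2,ℝ)`. -/
structure Schottky where
  r : ℕ
  two_le_r : 2 ≤ r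
  center : Fin (2 * r) → ℝ
  radius : Fin (2 * r) → ℝ
  radius_pos : ∀ a, 0 < radius a
  g : Fin (2 * r) → SL2
  disjoint : ∀ a b : Fin (2 * r), a ≠ b →
    Disjoint (closure (Metric.ball ((center a : ℂ)) (radius a)))
             (closure (Metric.ball ((center b : ℂ)) (radius b)))
  g_bar : ∀ a : Fin (2 * r), g (wordBar a) = (g a)⁻¹
  maps : ∀ a : Fin (2 * r),
    mobiusS (g a) '' (((fun w : ℂ => (w : OnePoint ℂ)) ''
        Metric.ball ((center (wordBar a) : ℂ)) (radius (wordBar a)))ᶜ)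
      = (fun w : ℂ => (w : OnePoint ℂ)) '' closure (Metric.ball ((center a : ℂ)) (radius a))

namespace Schottky

variable (S : Schottky)

/-- The open disc `D_a`. -/
def D (a : Fin (2 * S.r)) : Set ℂ := Metric.ball ((S.center a : ℂ)) (S.radius a)

/-- The union `𝐃` of the open discs. -/
def Dall : Set ℂ := ⋃ a, S.D a

/-- The open interval `I_a = D_a ∩ ℝ`. -/
def Ireal (a : Fin (2 * S.r)) : Set ℝ := {x : ℝ | (x : ℂ) ∈ S.D a}

/-- The union `I` of the intervals `I_a`. -/
def Iall : Set ℝ := ⋃ a, S.Ireal a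

/-- The group element `γ_𝐚 = γ_{a₁} ⋯ γ_{a_n}` associated to a word. -/
noncomputable def wprod (w : List (Fin (2 * S.r))) : SL2 := (w.map S.g).prod

/-- The Schottky group `Γ`, generated by the `γ_a`. -/
def SGroup : Subgroup SL2 := Subgroup.closure (Set.range S.g)

theorem wprod_mem (w : List (Fin (2 * S.r))) : S.wprod w ∈ S.SGroup := by
  apply Subgroup.list_prod_mem
  intro x hx
  obtain ⟨a, -, rfl⟩ := List.mem_map.mp hx
  exact Subgroup.subset_closure ⟨a, rfl⟩

/-- `γ_𝐚` as an element of the Schottky group `Γ`. -/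
noncomputable def wprodG (w : List (Fin (2 * S.r))) : S.SGroup := ⟨S.wprod w, S.wprod_mem w⟩

/-- The generator `γ_a` as an element of `Γ`. -/
noncomputable def genG (a : Fin (2 * S.r)) : S.SGroup :=
  ⟨S.g a, Subgroup.subset_closure ⟨a, rfl⟩⟩

/-- The interval `I_𝐚 = γ_{𝐚'}(I_{a_n})` of a nonempty word. -/
noncomputable def Iset (w : List (Fin (2 * S.r))) : Set ℝ :=
  if h : w = [] then ∅ else mobiusR (S.wprod w.dropLast) '' S.Ireal (w.getLast h)

/-- `Υ_𝐚 = |I_𝐚|`, the length of the interval `I_𝐚`; `Υ_∅ = 1`. -/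
noncomputable def ups (w : List (Fin (2 * S.r))) : ℝ :=
  if w = [] then 1 else (volume (S.Iset w)).toReal

/-- The Bourgain–Dyatlov partition `Z(τ)`. -/
def Zset (τ : ℝ) : Set (List (Fin (2 * S.r))) :=
  {w | IsWord w ∧ w ≠ [] ∧ S.ups w ≤ τ ∧ τ < S.ups w.dropLast}

/-- The mirror set `Z̄(τ) = {𝐚 ∈ 𝒲 : 𝐚̄ ∈ Z(τ)}`. -/
def Zbar (τ : ℝ) : Set (List (Fin (2 * S.r))) :=
  {w | IsWord w ∧ mirror w ∈ S.Zset τ}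

open Classical in
/-- The Bowen–Series map on the Riemann sphere (junk value `∞` off `𝐃`). -/
noncomputable def TS (z : OnePoint ℂ) : OnePoint ℂ :=
  if h : ∃ a : Fin (2 * S.r), ∃ w : ℂ, z = (w : OnePoint ℂ) ∧ w ∈ S.D a
  then mobiusS (S.g h.choose)⁻¹ z
  else OnePoint.infty

/-- The limit set `Λ`: points of `𝐃` all of whose forward iterates under the Bowen–Series
map are defined (finite) and remain in `𝐃`. -/
def limitSet : Set ℂ :=
  {z : ℂ | ∀ n : ℕ, ∃ w : ℂ, (S.TS)^[n] (z : OnePoint ℂ) = (w : OnePoint ℂ) ∧ w ∈ S.Dall}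

/-- The limit set, viewed inside `ℝ`. -/
def limitSetR : Set ℝ := {x : ℝ | (x : ℂ) ∈ S.limitSet}

/-- `δ`, the Hausdorff dimension of the limit set. -/
noncomputable def delta : ℝ := (dimH S.limitSet).toReal

/-- `PowerPairs(τ)`: pairs `(𝐚,𝐛) ∈ Z̄(τ)²` such that `γ_{𝐚'}γ_{𝐛'}⁻¹` is a nontrivial
proper power in `Γ`. -/
def PowerPairs (τ : ℝ) : Set (List (Fin (2 * S.r)) × List (Fin (2 * S.r))) :=
  {p | p.1 ∈ S.Zbar τ ∧ p.2 ∈ S.Zbar τ ∧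
    S.wprod p.1.dropLast * (S.wprod p.2.dropLast)⁻¹ ≠ 1 ∧
    ∃ γ₀ ∈ S.SGroup, ∃ q : ℕ, 2 ≤ q ∧
      S.wprod p.1.dropLast * (S.wprod p.2.dropLast)⁻¹ = (γ₀ : SL2) ^ q}

end Schottky

open scoped BigOperators

/-- The denominator `uz + v` of the Möbius transformation of `g`. -/
noncomputable def mobiusDen (g : SL2) (z : ℂ) : ℂ :=
  (g.1 1 0 : ℂ) * z + (g.1 1 1 : ℂ)

theorem mobiusDerivC_eq (g : SL2) (z : ℂ) : mobiusDerivC g z = (mobiusDen g z)⁻¹ ^ 2 := rfl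

theorem mobiusDen_mul (g h : SL2) {z : ℂ} (hz : mobiusDen h z ≠ 0) :
    mobiusDen (g * h) z = mobiusDen g (mobiusC h z) * mobiusDen h z := by
  unfold mobiusDen mobiusC at *
  simp only [Matrix.SpecialLinearGroup.coe_mul, Matrix.mul_apply, Fin.sum_univ_two]
  push_cast
  field_simp
  ring

theorem mobiusC_mul (g h : SL2) {z : ℂ} (hz : mobiusDen h z ≠ 0) :
    mobiusC (g * h) z = mobiusC g (mobiusC h z) := by
  have hden := mobiusDen_mul g h hz
  unfold mobiusC
  change _ / mobiusDen (g * h) z = _ / mobiusDen g (mobiusC h z)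
  rw [hden]
  by_cases h0 : mobiusDen g (mobiusC h z) = 0
  · simp [h0]
  rw [div_eq_div_iff (mul_ne_zero h0 hz) h0]
  unfold mobiusDen mobiusC at *
  simp only [Matrix.SpecialLinearGroup.coe_mul, Matrix.mul_apply, Fin.sum_univ_two]
  push_cast
  field_simp
  ring

theorem mobiusDen_one (z : ℂ) : mobiusDen 1 z = 1 := by simp [mobiusDen]

theorem mobiusC_one (z : ℂ) : mobiusC 1 z = z := by simp [mobiusC]

theorem ofReal_mobiusR (g : SL2) (x : ℝ) : ((mobiusR g x : ℝ) : ℂ) = mobiusC g x := by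
  simp [mobiusR, mobiusC]

theorem mobiusDen_re (g : SL2) (z : ℂ) : (mobiusDen g z).re = g.1 1 0 * z.re + g.1 1 1 := by
  simp [mobiusDen]

theorem mobiusDen_ofReal (g : SL2) (x : ℝ) :
    mobiusDen g x = ((g.1 1 0 * x + g.1 1 1 : ℝ) : ℂ) := by
  simp [mobiusDen]

theorem mobiusDen_ofReal_ne_zero {g : SL2} {x : ℝ} :
    mobiusDen g x ≠ 0 ↔ g.1 1 0 * x + g.1 1 1 ≠ 0 := by
  rw [mobiusDen_ofReal, Ne, Complex.ofReal_eq_zero]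

theorem mobiusS_coe (g : SL2) (w : ℂ) :
    mobiusS g (w : OnePoint ℂ) =
      if mobiusDen g w = 0 then OnePoint.infty else ((mobiusC g w : ℂ) : OnePoint ℂ) := rfl

theorem wordBar_wordBar {r : ℕ} (a : Fin (2 * r)) : wordBar (wordBar a) = a := by
  ext
  have ha := a.isLt
  simp only [wordBar]
  by_cases h : a.1 < r
  · rw [Nat.mod_eq_of_lt (by omega : a.1 + r < 2 * r)]
    rw [show a.1 + r + r = a.1 + 2 * r by ring, Nat.add_mod_right, Nat.mod_eq_of_lt ha]
  · rw [show a.1 + r = (a.1 - r) + 2 * r by omega, Nat.add_mod_right,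
      Nat.mod_eq_of_lt (by omega : a.1 - r < 2 * r)]
    rw [Nat.sub_add_cancel (by omega), Nat.mod_eq_of_lt ha]

theorem ne_wordBar_comm {r : ℕ} {a b : Fin (2 * r)} : a ≠ wordBar b ↔ b ≠ wordBar a := by
  constructor <;> rintro h rfl <;> exact h (wordBar_wordBar _).symm

theorem isWord_cons {r : ℕ} {a : Fin (2 * r)} {w : List (Fin (2 * r))} :
    IsWord (a :: w) ↔ (∀ b ∈ w.head?, a ≠ wordBar b) ∧ IsWord w :=
  List.isChain_cons

theorem isWord_append {r : ℕ} {v w : List (Fin (2 * r))} :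
    IsWord (v ++ w) ↔ IsWord v ∧ IsWord w ∧
      ∀ a ∈ v.getLast?, ∀ b ∈ w.head?, a ≠ wordBar b :=
  List.isChain_append

theorem IsWord.mirror {r : ℕ} {w : List (Fin (2 * r))} (hw : IsWord w) : IsWord (mirror w) := by
  unfold _root_.mirror IsWord
  refine List.isChain_reverse.2 ((List.isChain_map _).2 (List.IsChain.imp ?_ hw))
  intro a b hab h
  rw [wordBar_wordBar] at h
  exact hab h.symm

theorem mirror_cons {r : ℕ} (a : Fin (2 * r)) (w : List (Fin (2 * r))) :
    mirror (a :: w) = mirror w ++ [wordBar a] := by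
  simp [mirror]

namespace Schottky

variable (S : Schottky)

theorem wprod_cons (a : Fin (2 * S.r)) (w : List (Fin (2 * S.r))) :
    S.wprod (a :: w) = S.g a * S.wprod w := by simp [wprod]

theorem wprod_nil : S.wprod [] = 1 := by simp [wprod]

theorem wprod_append (v w : List (Fin (2 * S.r))) :
    S.wprod (v ++ w) = S.wprod v * S.wprod w := by simp [wprod]

theorem mobiusDen_gen_ne_zero {a : Fin (2 * S.r)} {z : ℂ} (hz : z ∉ S.D (wordBar a)) :
    mobiusDen (S.g a) z ≠ 0 ∧ mobiusC (S.g a) z ∈ closure (S.D a) := by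
  have hmem : mobiusS (S.g a) (z : OnePoint ℂ) ∈
      (fun w : ℂ => (w : OnePoint ℂ)) '' closure (S.D a) := by
    unfold D
    rw [← S.maps a]
    refine ⟨_, ?_, rfl⟩
    rintro ⟨w, hw, h⟩
    exact hz (OnePoint.coe_injective h ▸ hw)
  obtain ⟨y, hy, h⟩ := hmem
  rw [mobiusS_coe] at h
  split_ifs at h with h0
  · exact absurd h (OnePoint.coe_ne_infty y)
  · exact ⟨h0, OnePoint.coe_injective h ▸ hy⟩

theorem disjoint_closure {a b : Fin (2 * S.r)} (hab : a ≠ b) {z : ℂ}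
    (hz : z ∈ closure (S.D a)) : z ∉ closure (S.D b) :=
  fun h => Set.disjoint_left.1 (S.disjoint a b hab) hz h

theorem mobiusC_gen_mem {a b : Fin (2 * S.r)} (hab : a ≠ wordBar b) {z : ℂ}
    (hz : z ∈ S.D b) : mobiusC (S.g a) z ∈ S.D a := by
  have hcl : z ∉ closure (S.D (wordBar a)) :=
    S.disjoint_closure (ne_wordBar_comm.1 hab) (subset_closure hz)
  have h1 := S.mobiusDen_gen_ne_zero fun h => hcl (subset_closure h)
  by_contra hy
  rw [← wordBar_wordBar a] at hy
  have h2 := (S.mobiusDen_gen_ne_zero hy).2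
  rw [wordBar_wordBar, ← mobiusC_mul _ _ h1.1, S.g_bar, inv_mul_cancel, mobiusC_one] at h2
  exact hcl h2

/-- The pole of `γ_𝐚` lies in the disc of the bar of the last letter. -/
theorem mobiusDen_wprod_ne_zero {w : List (Fin (2 * S.r))} (hw : IsWord w) {z : ℂ}
    (hz : ∀ a ∈ w.getLast?, z ∉ S.D (wordBar a)) :
    mobiusDen (S.wprod w) z ≠ 0 ∧ ∀ a ∈ w.head?, mobiusC (S.wprod w) z ∈ closure (S.D a) := by
  induction w with
  | nil => simp [wprod_nil, mobiusDen_one]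
  | cons a w ih =>
    rw [isWord_cons] at hw
    have key : mobiusDen (S.wprod w) z ≠ 0 ∧ mobiusC (S.wprod w) z ∉ S.D (wordBar a) := by
      cases w with
      | nil => simpa [wprod_nil, mobiusDen_one, mobiusC_one] using hz
      | cons b w =>
        obtain ⟨h1, h2⟩ := ih hw.2 (by simpa using hz)
        refine ⟨h1, fun h => S.disjoint_closure ?_ (h2 b rfl) (subset_closure h)⟩
        exact ne_wordBar_comm.1 (hw.1 b rfl)
    have h3 := S.mobiusDen_gen_ne_zero key.2
    rw [wprod_cons, mobiusDen_mul _ _ key.1, mobiusC_mul _ _ key.1]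
    refine ⟨mul_ne_zero h3.1 key.1, ?_⟩
    simpa using h3.2

theorem mobiusDen_wprod_ne_zero_of_mem {w : List (Fin (2 * S.r))} {b : Fin (2 * S.r)}
    (hw : IsWord (w ++ [b])) {z : ℂ} (hz : z ∈ S.D b) : mobiusDen (S.wprod w) z ≠ 0 := by
  rw [isWord_append] at hw
  refine (S.mobiusDen_wprod_ne_zero hw.1 fun a ha h => ?_).1
  exact S.disjoint_closure (ne_wordBar_comm.1 (hw.2.2 a ha b rfl)) (subset_closure hz)
    (subset_closure h)

theorem mobiusC_wprod_mem {w : List (Fin (2 * S.r))} {b : Fin (2 * S.r)}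
    (hw : IsWord (w ++ [b])) {z : ℂ} (hz : z ∈ S.D b) :
    ∀ c ∈ (w ++ [b]).head?, mobiusC (S.wprod w) z ∈ S.D c := by
  induction w with
  | nil => simpa [wprod_nil, mobiusC_one] using hz
  | cons a w ih =>
    rw [List.cons_append, isWord_cons] at hw
    obtain ⟨c, hc⟩ : ∃ c, (w ++ [b]).head? = some c := by cases w <;> simp
    have h := S.mobiusC_gen_mem (hw.1 c hc) (ih hw.2 c hc)
    rw [wprod_cons, mobiusC_mul _ _ (S.mobiusDen_wprod_ne_zero_of_mem hw.2 hz)]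
    simpa using h

theorem ofReal_re_mem_D {b : Fin (2 * S.r)} {z : ℂ} (hz : z ∈ S.D b) :
    ((z.re : ℝ) : ℂ) ∈ S.D b := by
  simp only [D, Metric.mem_ball, Complex.dist_eq] at *
  rw [← Complex.ofReal_sub, Complex.norm_real]
  refine lt_of_le_of_lt ?_ hz
  simpa using Complex.abs_re_le_norm (z - S.center b)

theorem mem_Ireal {a : Fin (2 * S.r)} {x : ℝ} :
    x ∈ S.Ireal a ↔ |x - S.center a| < S.radius a := by
  change ((x : ℂ)) ∈ Metric.ball _ _ ↔ _
  rw [Metric.mem_ball, Complex.dist_eq, ← Complex.ofReal_sub, Complex.norm_real, Real.norm_eq_abs]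

end Schottky

theorem inv_sq_mul_cpow {z w : ℂ} (hz : 0 < z.re) (hw : 0 < w.re) (hzw : 0 < (z * w).re) (s : ℂ) :
    ((z * w)⁻¹ ^ 2) ^ s = (z⁻¹ ^ 2) ^ s * (w⁻¹ ^ 2) ^ s := by
  have ne (t : ℂ) (ht : 0 < t.re) : t ≠ 0 := by rintro rfl; simp at ht
  have harg (t : ℂ) (ht : 0 < t.re) := abs_lt.1 (Complex.abs_arg_lt_pi_div_two_iff.2 (Or.inl ht))
  have hlog (t : ℂ) (ht : 0 < t.re) : Complex.log (t⁻¹ ^ 2) = -(2 * Complex.log t) := by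
    have h := harg t ht
    rw [inv_pow, Complex.log_inv, sq, Complex.log_mul (ne t ht) (ne t ht)]
    · ring
    · constructor <;> linarith
    · intro h'
      have h2 : Complex.arg (t * t) = t.arg + t.arg :=
        Complex.arg_mul (ne t ht) (ne t ht) (by constructor <;> linarith)
      rw [← sq, h'] at h2
      linarith
  have hnz (t : ℂ) (ht : 0 < t.re) : t⁻¹ ^ 2 ≠ 0 := pow_ne_zero _ (inv_ne_zero (ne t ht))
  rw [Complex.cpow_def_of_ne_zero (hnz _ hzw), Complex.cpow_def_of_ne_zero (hnz _ hz),
    Complex.cpow_def_of_ne_zero (hnz _ hw), ← Complex.exp_add, hlog _ hzw, hlog _ hz, hlog _ hw,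
    Complex.log_mul (ne z hz) (ne w hw)
      (by have := harg z hz; have := harg w hw; constructor <;> linarith)]
  congr 1
  ring

theorem inv_sq_mul_cpow_of_pos {z w : ℂ} (h : 0 < z.re * w.re * (z * w).re) (s : ℂ) :
    ((z * w)⁻¹ ^ 2) ^ s = (z⁻¹ ^ 2) ^ s * (w⁻¹ ^ 2) ^ s := by
  wlog hz : 0 < z.re generalizing z
  · have hz' : 0 < (-z).re := by
      rcases lt_trichotomy z.re 0 with h' | h' | h'
      · simpa using h'
      · simp [h'] at h
      · exact absurd h' hz
    simpa [neg_mul, inv_neg] using this (z := -z)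
      (by simpa only [neg_mul, mul_neg, Complex.neg_re, neg_neg] using h) hz'
  wlog hw : 0 < w.re generalizing w
  · have hw' : 0 < (-w).re := by
      rcases lt_trichotomy w.re 0 with h' | h' | h'
      · simpa using h'
      · simp [h'] at h
      · exact absurd h' hw
    simpa [mul_neg, inv_neg] using this (w := -w)
      (by simpa only [neg_mul, mul_neg, Complex.neg_re, neg_neg] using h) hw'
  exact inv_sq_mul_cpow hz hw (pos_of_mul_pos_right h (by positivity)) s

/-- A nonvanishing affine function has bounded distortion. -/
theorem abs_affine_le {α β c R d x y : ℝ} (hd : 0 < d)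
    (h : ∀ t, |t - c| < R + d → α * t + β ≠ 0) (hx : |x - c| < R) (hy : |y - c| < R) :
    |α * x + β| ≤ (1 + 2 * R / d) * |α * y + β| := by
  have hR : 0 < R := (abs_nonneg _).trans_lt hx
  rcases eq_or_ne α 0 with rfl | hα
  · have : 0 ≤ 2 * R / d := by positivity
    simp only [zero_mul, zero_add]
    nlinarith [abs_nonneg β]
  have h1 : d ≤ |y - -β / α| := by
    by_contra! hlt
    refine h (-β / α) ?_ (by field_simp; ring)
    have := abs_sub_le (-β / α) y c
    rw [abs_sub_comm] at hlt
    linarith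
  have h2 : |α * y + β| = |α| * |y - -β / α| := by
    rw [← abs_mul]; congr 1; field_simp; ring
  have h3 : |α * x + β| ≤ |α * y + β| + |α| * |x - y| := by
    rw [← abs_mul]
    refine le_trans (le_of_eq ?_) (abs_add_le _ _)
    congr 1; ring
  have h4 : |x - y| ≤ 2 * R := by
    have := abs_sub_le x c y
    rw [abs_sub_comm c y] at this
    linarith
  have h5 : |α| * |x - y| ≤ 2 * R / d * |α * y + β| := by
    rw [h2, div_mul_eq_mul_div, le_div_iff₀ hd]
    have : |α| * d ≤ |α| * |y - -β / α| := by gcongr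
    have : |α| * |x - y| * d ≤ |α| * (2 * R) * d := by gcongr
    nlinarith
  linarith

theorem mobiusR_injOn {g : SL2} {E : Set ℝ} (hE : ∀ x ∈ E, g.1 1 0 * x + g.1 1 1 ≠ 0) :
    Set.InjOn (mobiusR g) E := by
  intro x hx y hy hxy
  have hdet := g.2
  rw [Matrix.det_fin_two] at hdet
  simp only [mobiusR] at hxy
  rw [div_eq_div_iff (hE x hx) (hE y hy)] at hxy
  have : (g.1 0 0 * g.1 1 1 - g.1 0 1 * g.1 1 0) * (x - y) = 0 := by linear_combination hxy
  rw [hdet, one_mul] at this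
  linarith

theorem hasDerivAt_mobiusR {g : SL2} {x : ℝ} (hx : g.1 1 0 * x + g.1 1 1 ≠ 0) :
    HasDerivAt (mobiusR g) (mobiusDerivR g x) x := by
  have h1 : HasDerivAt (fun x => g.1 0 0 * x + g.1 0 1) (g.1 0 0) x := by
    simpa using ((hasDerivAt_id x).const_mul (g.1 0 0)).add_const (g.1 0 1)
  have h2 : HasDerivAt (fun x => g.1 1 0 * x + g.1 1 1) (g.1 1 0) x := by
    simpa using ((hasDerivAt_id x).const_mul (g.1 1 0)).add_const (g.1 1 1)
  refine (h1.div h2 hx).congr_deriv ?_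
  have hdet := g.2
  rw [Matrix.det_fin_two] at hdet
  unfold mobiusDerivR
  rw [inv_pow, ← one_div]
  congr 1
  linear_combination hdet

theorem measurableSet_mobiusR_image {g : SL2} {E : Set ℝ} (hm : MeasurableSet E)
    (hE : ∀ x ∈ E, g.1 1 0 * x + g.1 1 1 ≠ 0) : MeasurableSet (mobiusR g '' E) :=
  hm.image_of_continuousOn_injOn
    (fun x hx => (hasDerivAt_mobiusR (hE x hx)).continuousAt.continuousWithinAt)
    (mobiusR_injOn hE)

theorem volume_mobiusR_image {g : SL2} {E : Set ℝ} (hm : MeasurableSet E)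
    (hE : ∀ x ∈ E, g.1 1 0 * x + g.1 1 1 ≠ 0) :
    volume (mobiusR g '' E) = ∫⁻ x in E, ENNReal.ofReal (mobiusDerivR g x) := by
  have h := lintegral_image_eq_lintegral_abs_deriv_mul hm
    (fun x hx => (hasDerivAt_mobiusR (hE x hx)).hasDerivWithinAt) (mobiusR_injOn hE) fun _ => 1
  simp only [lintegral_const, one_mul, mul_one, Measure.restrict_apply MeasurableSet.univ,
    Set.univ_inter] at h
  rw [h]
  congr 1 with x
  rw [abs_of_nonneg (by unfold mobiusDerivR; positivity)]

theorem volume_mobiusR_image_le {g : SL2} {E : Set ℝ} {B : ℝ} (hm : MeasurableSet E)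
    (hE : ∀ x ∈ E, g.1 1 0 * x + g.1 1 1 ≠ 0) (hB : ∀ x ∈ E, mobiusDerivR g x ≤ B) :
    volume (mobiusR g '' E) ≤ ENNReal.ofReal B * volume E := by
  rw [volume_mobiusR_image hm hE, ← setLIntegral_const]
  exact setLIntegral_mono' hm fun x hx => ENNReal.ofReal_le_ofReal (hB x hx)

theorem le_volume_mobiusR_image {g : SL2} {E : Set ℝ} {A : ℝ} (hm : MeasurableSet E)
    (hE : ∀ x ∈ E, g.1 1 0 * x + g.1 1 1 ≠ 0) (hA : ∀ x ∈ E, A ≤ mobiusDerivR g x) :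
    ENNReal.ofReal A * volume E ≤ volume (mobiusR g '' E) := by
  rw [volume_mobiusR_image hm hE, ← setLIntegral_const]
  exact setLIntegral_mono' hm fun x hx => ENNReal.ofReal_le_ofReal (hA x hx)

theorem Set.InjOn.disjoint_image_of_subset {α β : Type*} {f : α → β} {s t u : Set α}
    (hf : Set.InjOn f u) (hs : s ⊆ u) (ht : t ⊆ u) (hst : Disjoint s t) :
    Disjoint (f '' s) (f '' t) := by
  rw [Set.disjoint_iff_inter_eq_empty, ← hf.image_inter hs ht,
    Set.disjoint_iff_inter_eq_empty.1 hst, Set.image_empty]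

namespace Schottky

variable (S : Schottky)

theorem Ireal_eq (a : Fin (2 * S.r)) :
    S.Ireal a = Set.Ioo (S.center a - S.radius a) (S.center a + S.radius a) := by
  ext x
  rw [mem_Ireal, abs_lt, Set.mem_Ioo]
  constructor <;> rintro ⟨h1, h2⟩ <;> constructor <;> linarith

theorem measurableSet_Ireal (a : Fin (2 * S.r)) : MeasurableSet (S.Ireal a) := by
  rw [Ireal_eq]; exact measurableSet_Ioo

theorem volume_Ireal (a : Fin (2 * S.r)) :
    volume (S.Ireal a) = ENNReal.ofReal (2 * S.radius a) := by
  rw [Ireal_eq, Real.volume_Ioo]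
  congr 1; ring

theorem exists_gap : ∃ d > 0, ∀ a b : Fin (2 * S.r), a ≠ b → ∀ t : ℝ,
    |t - S.center a| < S.radius a + d → (t : ℂ) ∉ S.D b := by
  have hd : ∀ᶠ d in nhdsWithin (0 : ℝ) (Set.Ioi 0), ∀ p : Fin (2 * S.r) × Fin (2 * S.r),
      p.1 ≠ p.2 → d ≤ |S.center p.1 - S.center p.2| - S.radius p.1 - S.radius p.2 := by
    refine Filter.eventually_all.2 fun p => ?_
    by_cases hp : p.1 = p.2
    · simp [hp]
    have h := S.disjoint p.1 p.2 hp
    rw [closure_ball _ (S.radius_pos _).ne', closure_ball _ (S.radius_pos _).ne',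
      disjoint_closedBall_closedBall_iff (S.radius_pos _).le (S.radius_pos _).le,
      Complex.dist_eq, ← Complex.ofReal_sub, Complex.norm_real, Real.norm_eq_abs] at h
    have hpos : 0 < |S.center p.1 - S.center p.2| - S.radius p.1 - S.radius p.2 := by linarith
    filter_upwards [Ioo_mem_nhdsGT hpos] with d hd _ using hd.2.le
  obtain ⟨d, h, hd0⟩ := (hd.and self_mem_nhdsWithin).exists
  refine ⟨d, hd0, fun a b hab t ht htb => ?_⟩
  have h1 := S.mem_Ireal.1 htb
  have h2 := h (a, b) hab
  have h3 := abs_sub_le (S.center a) t (S.center b)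
  rw [abs_sub_comm (S.center a) t] at h3
  dsimp only at h2
  linarith

theorem exists_distortion : ∃ K > 0, ∀ (w : List (Fin (2 * S.r))) (a : Fin (2 * S.r)),
    IsWord (w ++ [a]) → ∀ x ∈ S.Ireal a, ∀ y ∈ S.Ireal a,
      mobiusDerivR (S.wprod w) x ≤ K * mobiusDerivR (S.wprod w) y := by
  obtain ⟨d, hd, hgap⟩ := S.exists_gap
  have hR : 0 ≤ ∑ a, S.radius a := Finset.sum_nonneg fun a _ => (S.radius_pos a).le
  refine ⟨(1 + 2 * (∑ a, S.radius a) / d) ^ 2, by positivity, fun w a hw x hx y hy => ?_⟩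
  have hx0 := mobiusDen_ofReal_ne_zero.1 (S.mobiusDen_wprod_ne_zero_of_mem hw hx)
  have hy0 := mobiusDen_ofReal_ne_zero.1 (S.mobiusDen_wprod_ne_zero_of_mem hw hy)
  have hne : ∀ t, |t - S.center a| < S.radius a + d →
      (S.wprod w).1 1 0 * t + (S.wprod w).1 1 1 ≠ 0 := by
    intro t ht
    rw [isWord_append] at hw
    refine mobiusDen_ofReal_ne_zero.1 (S.mobiusDen_wprod_ne_zero hw.1 fun b hb => ?_).1
    exact hgap a _ (ne_wordBar_comm.1 (hw.2.2 b hb a rfl)) t ht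
  have h := abs_affine_le hd hne (S.mem_Ireal.1 hy) (S.mem_Ireal.1 hx)
  have hle : S.radius a ≤ ∑ a, S.radius a :=
    Finset.single_le_sum (fun a _ => (S.radius_pos a).le) (Finset.mem_univ a)
  have h' : |(S.wprod w).1 1 0 * y + (S.wprod w).1 1 1| ≤
      (1 + 2 * (∑ a, S.radius a) / d) * |(S.wprod w).1 1 0 * x + (S.wprod w).1 1 1| :=
    h.trans (by gcongr)
  unfold mobiusDerivR
  rw [inv_pow, inv_pow, ← div_eq_mul_inv, inv_eq_one_div,
    div_le_div_iff₀ (by positivity) (by positivity), one_mul, ← sq_abs, ← sq_abs (_ * x + _),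
    ← mul_pow]
  gcongr

theorem den_ne_zero_of_mem_Ireal {w : List (Fin (2 * S.r))} {a : Fin (2 * S.r)}
    (hw : IsWord (w ++ [a])) {x : ℝ} (hx : x ∈ S.Ireal a) :
    (S.wprod w).1 1 0 * x + (S.wprod w).1 1 1 ≠ 0 :=
  mobiusDen_ofReal_ne_zero.1 (S.mobiusDen_wprod_ne_zero_of_mem hw hx)

theorem center_mem_Ireal (a : Fin (2 * S.r)) : S.center a ∈ S.Ireal a := by
  rw [mem_Ireal]; simpa using S.radius_pos a

theorem mobiusDerivR_center_pos {w : List (Fin (2 * S.r))} {a : Fin (2 * S.r)}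
    (hw : IsWord (w ++ [a])) : 0 < mobiusDerivR (S.wprod w) (S.center a) := by
  have := S.den_ne_zero_of_mem_Ireal hw (S.center_mem_Ireal a)
  unfold mobiusDerivR
  positivity

theorem volume_image_ne_top {w : List (Fin (2 * S.r))} {a : Fin (2 * S.r)}
    (hw : IsWord (w ++ [a])) : volume (mobiusR (S.wprod w) '' S.Ireal a) ≠ ⊤ := by
  obtain ⟨K, hK, h⟩ := S.exists_distortion
  refine ne_top_of_le_ne_top ?_ (volume_mobiusR_image_le (S.measurableSet_Ireal a)
    (fun x hx => S.den_ne_zero_of_mem_Ireal hw hx)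
    fun x hx => h w a hw x hx _ (S.center_mem_Ireal a))
  rw [volume_Ireal]
  exact ENNReal.mul_ne_top ENNReal.ofReal_ne_top ENNReal.ofReal_ne_top

theorem volume_image_pos {w : List (Fin (2 * S.r))} {a : Fin (2 * S.r)}
    (hw : IsWord (w ++ [a])) : 0 < volume.real (mobiusR (S.wprod w) '' S.Ireal a) := by
  obtain ⟨K, hK, h⟩ := S.exists_distortion
  refine ENNReal.toReal_pos (ne_of_gt (lt_of_lt_of_le ?_ (le_volume_mobiusR_image
    (A := K⁻¹ * mobiusDerivR (S.wprod w) (S.center a)) (S.measurableSet_Ireal a)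
    (fun x hx => S.den_ne_zero_of_mem_Ireal hw hx) fun x hx => ?_))) (S.volume_image_ne_top hw)
  · have h1 := S.mobiusDerivR_center_pos hw
    have h2 := S.radius_pos a
    rw [volume_Ireal]
    exact ENNReal.mul_pos (by simp; positivity) (by simp; positivity)
  · rw [inv_mul_le_iff₀ hK]
    exact h w a hw _ (S.center_mem_Ireal a) x hx

/-- Up to a uniform constant, `γ_𝐰` preserves the proportion of a subset of `I_a`. -/
theorem exists_proportion : ∃ K > 0, ∀ (w : List (Fin (2 * S.r))) (a : Fin (2 * S.r)),
    IsWord (w ++ [a]) → ∀ E ⊆ S.Ireal a, MeasurableSet E →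
      volume.real E * volume.real (mobiusR (S.wprod w) '' S.Ireal a) ≤
        K * volume.real (S.Ireal a) * volume.real (mobiusR (S.wprod w) '' E) := by
  obtain ⟨K, hK, h⟩ := S.exists_distortion
  refine ⟨K * K, by positivity, fun w a hw E hE hm => ?_⟩
  have hc := S.center_mem_Ireal a
  have h0 := S.mobiusDerivR_center_pos hw
  have hfin : volume (S.Ireal a) ≠ ⊤ := by rw [volume_Ireal]; exact ENNReal.ofReal_ne_top
  have h1 := ENNReal.toReal_mono (ENNReal.mul_ne_top ENNReal.ofReal_ne_top hfin)
    (volume_mobiusR_image_le (S.measurableSet_Ireal a)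
      (fun x hx => S.den_ne_zero_of_mem_Ireal hw hx) fun x hx => h w a hw x hx _ hc)
  have h2 := ENNReal.toReal_mono
    (measure_ne_top_of_subset (Set.image_mono hE) (S.volume_image_ne_top hw))
    (le_volume_mobiusR_image (A := K⁻¹ * mobiusDerivR (S.wprod w) (S.center a)) hm
      (fun x hx => S.den_ne_zero_of_mem_Ireal hw (hE hx)) fun x hx => by
        rw [inv_mul_le_iff₀ hK]
        exact h w a hw _ hc x (hE hx))
  rw [ENNReal.toReal_mul, ENNReal.toReal_ofReal (by positivity)] at h1 h2
  change volume.real _ ≤ _ * volume.real _ at h1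
  change _ * volume.real _ ≤ volume.real _ at h2
  calc volume.real E * volume.real (mobiusR (S.wprod w) '' S.Ireal a)
      ≤ volume.real E * (K * mobiusDerivR (S.wprod w) (S.center a) *
          volume.real (S.Ireal a)) := by gcongr
    _ = K * K * volume.real (S.Ireal a) *
          (K⁻¹ * mobiusDerivR (S.wprod w) (S.center a) * volume.real E) := by field_simp
    _ ≤ _ := by gcongr

theorem mobiusR_gen_mem {a c : Fin (2 * S.r)} (hac : a ≠ wordBar c) {x : ℝ}
    (hx : x ∈ S.Ireal c) : mobiusR (S.g a) x ∈ S.Ireal a := by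
  change ((mobiusR (S.g a) x : ℝ) : ℂ) ∈ S.D a
  rw [ofReal_mobiusR]
  exact S.mobiusC_gen_mem hac hx

theorem ups_concat (w : List (Fin (2 * S.r))) (a : Fin (2 * S.r)) :
    S.ups (w ++ [a]) = volume.real (mobiusR (S.wprod w) '' S.Ireal a) := by
  simp [ups, Iset, Measure.real]

theorem wprod_singleton (a : Fin (2 * S.r)) : S.wprod [a] = S.g a := by simp [wprod]

theorem isWord_pair {a c : Fin (2 * S.r)} : IsWord ([a] ++ [c]) ↔ a ≠ wordBar c :=
  List.isChain_pair

theorem gen_image_subset {a c : Fin (2 * S.r)} (hac : a ≠ wordBar c) :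
    mobiusR (S.g a) '' S.Ireal c ⊆ S.Ireal a :=
  Set.image_subset_iff.2 fun _ hx => S.mobiusR_gen_mem hac hx

theorem measurableSet_gen_image {a c : Fin (2 * S.r)} (hac : a ≠ wordBar c) :
    MeasurableSet (mobiusR (S.g a) '' S.Ireal c) := by
  rw [← wprod_singleton]
  exact measurableSet_mobiusR_image (S.measurableSet_Ireal c)
    fun x hx => S.den_ne_zero_of_mem_Ireal (S.isWord_pair.2 hac) hx

theorem disjoint_gen_image {a c e : Fin (2 * S.r)} (hac : a ≠ wordBar c) (hae : a ≠ wordBar e)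
    (hce : c ≠ e) :
    Disjoint (mobiusR (S.g a) '' S.Ireal c) (mobiusR (S.g a) '' S.Ireal e) := by
  have hinj : Set.InjOn (mobiusR (S.g a)) (S.Ireal c ∪ S.Ireal e) := by
    refine mobiusR_injOn ?_
    rw [← wprod_singleton]
    rintro x (hx | hx)
    · exact S.den_ne_zero_of_mem_Ireal (S.isWord_pair.2 hac) hx
    · exact S.den_ne_zero_of_mem_Ireal (S.isWord_pair.2 hae) hx
  refine hinj.disjoint_image_of_subset Set.subset_union_left Set.subset_union_right ?_
  exact Set.disjoint_left.2 fun x hx hx' =>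
    S.disjoint_closure hce (subset_closure hx) (subset_closure hx')

theorem exists_other_letter (a c : Fin (2 * S.r)) : ∃ e, e ≠ c ∧ a ≠ wordBar e := by
  have hcard : ({c, wordBar a} : Finset (Fin (2 * S.r))).card <
      Fintype.card (Fin (2 * S.r)) := by
    have := S.two_le_r
    have := Finset.card_le_two (a := c) (b := wordBar a)
    rw [Fintype.card_fin]
    omega
  obtain ⟨e, he⟩ : ∃ e, e ∉ ({c, wordBar a} : Finset (Fin (2 * S.r))) := by
    by_contra! h
    rw [Finset.eq_univ_of_forall h, Finset.card_univ] at hcard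
    exact hcard.false
  simp only [Finset.mem_insert, Finset.mem_singleton, not_or] at he
  exact ⟨e, he.1, ne_wordBar_comm.1 he.2⟩

theorem exists_ups_contraction : ∃ θ : ℝ, 0 ≤ θ ∧ θ < 1 ∧ ∀ (v : List (Fin (2 * S.r)))
    (c : Fin (2 * S.r)), v ≠ [] → IsWord (v ++ [c]) → S.ups (v ++ [c]) ≤ θ * S.ups v := by
  obtain ⟨K, hK, hprop⟩ := S.exists_proportion
  have hη : ∀ᶠ η in nhdsWithin (0 : ℝ) (Set.Ioi 0), ∀ p : Fin (2 * S.r) × Fin (2 * S.r),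
      p.1 ≠ wordBar p.2 → η * (K * volume.real (S.Ireal p.1)) ≤
        volume.real (mobiusR (S.g p.1) '' S.Ireal p.2) := by
    refine Filter.eventually_all.2 fun p => ?_
    by_cases hp : p.1 = wordBar p.2
    · simp [hp]
    have hpos := S.volume_image_pos (S.isWord_pair.2 hp)
    rw [wprod_singleton] at hpos
    have hI : 0 < volume.real (S.Ireal p.1) := by
      have := S.radius_pos p.1
      rw [Measure.real, volume_Ireal, ENNReal.toReal_ofReal] <;> positivity
    filter_upwards [Ioo_mem_nhdsGT (div_pos hpos (mul_pos hK hI))] with η hη _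
    exact ((lt_div_iff₀ (mul_pos hK hI)).1 hη.2).le
  obtain ⟨η, ⟨h, hη1⟩, hη0⟩ :=
    ((hη.and (Ioo_mem_nhdsGT one_pos)).and self_mem_nhdsWithin).exists
  have hη0 : 0 < η := hη0
  refine ⟨1 - η, by linarith [hη1.2], by linarith, fun v c hv hvc => ?_⟩
  obtain ⟨w, a, rfl⟩ : ∃ w a, v = w ++ [a] :=
    ⟨_, _, (List.dropLast_append_getLast hv).symm⟩
  have hw := (isWord_append.1 hvc).1
  have hac : a ≠ wordBar c := (isWord_append.1 hvc).2.2 a (by simp) c rfl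
  obtain ⟨e, hec, hae⟩ := S.exists_other_letter a c
  have himg : mobiusR (S.wprod (w ++ [a])) '' S.Ireal c =
      mobiusR (S.wprod w) '' (mobiusR (S.g a) '' S.Ireal c) := by
    rw [Set.image_image]
    refine Set.image_congr fun x hx => Complex.ofReal_injective ?_
    rw [ofReal_mobiusR, ofReal_mobiusR, ofReal_mobiusR, wprod_append, wprod_singleton]
    refine mobiusC_mul _ _ ?_
    rw [← wprod_singleton]
    exact S.mobiusDen_wprod_ne_zero_of_mem (S.isWord_pair.2 hac) hx
  rw [ups_concat, ups_concat, himg]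
  set G := mobiusR (S.wprod w)
  set J := mobiusR (S.g a) '' S.Ireal c
  set L := mobiusR (S.g a) '' S.Ireal e
  have hJ : J ⊆ S.Ireal a := S.gen_image_subset hac
  have hL : L ⊆ S.Ireal a := S.gen_image_subset hae
  have hLm : MeasurableSet L := S.measurableSet_gen_image hae
  have hfin := S.volume_image_ne_top hw
  have hinj : Set.InjOn G (S.Ireal a) :=
    mobiusR_injOn fun x hx => S.den_ne_zero_of_mem_Ireal hw hx
  have hdisj : Disjoint (G '' J) (G '' L) :=
    hinj.disjoint_image_of_subset hJ hL (S.disjoint_gen_image hac hae hec.symm)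
  have hadd : volume.real (G '' J) + volume.real (G '' L) ≤ volume.real (G '' S.Ireal a) := by
    rw [← measureReal_union hdisj (measurableSet_mobiusR_image hLm fun x hx =>
      S.den_ne_zero_of_mem_Ireal hw (hL hx))
      (measure_ne_top_of_subset (Set.image_mono hJ) hfin)
      (measure_ne_top_of_subset (Set.image_mono hL) hfin)]
    exact measureReal_mono (Set.union_subset (Set.image_mono hJ) (Set.image_mono hL)) hfin
  have hI : 0 < volume.real (S.Ireal a) := by
    have := S.radius_pos a
    rw [Measure.real, volume_Ireal, ENNReal.toReal_ofReal] <;> positivity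
  have h1 := hprop w a hw L hL hLm
  have h2 := mul_le_mul_of_nonneg_right (h (a, e) hae)
    (measureReal_nonneg (μ := volume) (s := G '' S.Ireal a))
  have h3 : η * volume.real (G '' S.Ireal a) ≤ volume.real (G '' L) := by
    refine le_of_mul_le_mul_left ?_ (mul_pos hK hI)
    calc _ = η * (K * volume.real (S.Ireal a)) * volume.real (G '' S.Ireal a) := by ring
      _ ≤ _ := h2.trans h1
  linarith

theorem ups_nonneg (w : List (Fin (2 * S.r))) : 0 ≤ S.ups w := by
  unfold ups; split_ifs <;> positivity

theorem exists_length_bound {τ : ℝ} (hτ : 0 < τ) : ∃ N : ℕ, ∀ v : List (Fin (2 * S.r)),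
    IsWord v → N < v.length → S.ups v ≤ τ := by
  obtain ⟨θ, hθ0, hθ1, hθ⟩ := S.exists_ups_contraction
  set M := ∑ a, S.ups [a]
  have hM : ∀ n (v : List (Fin (2 * S.r))), IsWord v → v.length = n + 1 →
      S.ups v ≤ θ ^ n * M := by
    intro n
    induction n with
    | zero =>
      intro v _ hv
      obtain ⟨a, rfl⟩ := List.length_eq_one_iff.1 hv
      rw [pow_zero, one_mul]
      exact Finset.single_le_sum (f := fun a => S.ups [a]) (fun a _ => S.ups_nonneg _)
        (Finset.mem_univ a)
    | succ n ih =>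
      intro v hw hv
      have hne : v ≠ [] := by rintro rfl; simp at hv
      obtain ⟨w, c, rfl⟩ : ∃ w a, v = w ++ [a] :=
        ⟨_, _, (List.dropLast_append_getLast hne).symm⟩
      have hlen : w.length = n + 1 := by simpa using hv
      have h1 := hθ w c (by rintro rfl; simp at hlen) hw
      have h2 := ih w (isWord_append.1 hw).1 hlen
      calc _ ≤ _ := h1
        _ ≤ θ * (θ ^ n * M) := by gcongr
        _ = _ := by ring
  have hlim : Filter.Tendsto (fun n : ℕ => θ ^ n * M) Filter.atTop (nhds 0) := by
    simpa using (tendsto_pow_atTop_nhds_zero_of_lt_one hθ0 hθ1).mul_const M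
  obtain ⟨N, hN⟩ := Filter.eventually_atTop.1 (hlim.eventually (eventually_lt_nhds hτ))
  refine ⟨N, fun v hv hlen => ?_⟩
  obtain ⟨m, hm⟩ : ∃ m, v.length = m + 1 := ⟨v.length - 1, by omega⟩
  exact (hM m v hv hm).trans (hN m (by omega)).le

end Schottky

theorem affine_mul_pos {α β x y : ℝ} {E : Set ℝ} (hE : Convex ℝ E)
    (h : ∀ t ∈ E, α * t + β ≠ 0) (hx : x ∈ E) (hy : y ∈ E) :
    0 < (α * x + β) * (α * y + β) := by
  by_contra! hle
  have himg := hE.isPreconnected.image (fun t => α * t + β) (by fun_prop)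
  have hconn := himg.ordConnected
  have hmem : (0 : ℝ) ∈ (fun t => α * t + β) '' E := by
    rcases mul_nonpos_iff.1 hle with ⟨h1, h2⟩ | ⟨h1, h2⟩
    · exact hconn.out (Set.mem_image_of_mem _ hy) (Set.mem_image_of_mem _ hx) ⟨h2, h1⟩
    · exact hconn.out (Set.mem_image_of_mem _ hx) (Set.mem_image_of_mem _ hy) ⟨h1, h2⟩
  obtain ⟨t, ht, h0⟩ := hmem
  exact h t ht h0

namespace Schottky

variable (S : Schottky)

theorem mem_Zbar_cons {τ : ℝ} {a : Fin (2 * S.r)} {w : List (Fin (2 * S.r))} :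
    a :: w ∈ S.Zbar τ ↔
      IsWord (a :: w) ∧ S.ups (mirror (a :: w)) ≤ τ ∧ τ < S.ups (mirror w) := by
  simp only [Zbar, Zset, Set.mem_ofPred_eq, mirror_cons, List.dropLast_concat]
  refine ⟨fun h => ⟨h.1, h.2.2.2⟩, fun h => ⟨h.1, ?_, by simp, h.2⟩⟩
  simpa only [mirror_cons] using h.1.mirror

theorem ups_mirror_le_of_suffix {w z : List (Fin (2 * S.r))} (hw : w ≠ []) (hz : IsWord z)
    (hwz : w <:+ z) : S.ups (mirror z) ≤ S.ups (mirror w) := by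
  induction z with
  | nil => exact absurd (List.suffix_nil.1 hwz) hw
  | cons a z ih =>
    rcases List.suffix_cons_iff.1 hwz with rfl | h
    · exact le_rfl
    · refine le_trans ?_ (ih (isWord_cons.1 hz).2 h)
      obtain ⟨θ, hθ0, hθ1, hθ⟩ := S.exists_ups_contraction
      have hne : mirror z ≠ [] := by
        rintro hm
        have : z = [] := by simpa [mirror] using hm
        subst this
        exact hw (List.suffix_nil.1 h)
      have h1 := hθ (mirror z) (wordBar a) hne (by simpa only [mirror_cons] using hz.mirror)
      rw [mirror_cons]
      nlinarith [S.ups_nonneg (mirror z)]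

/-- Iterating a one-letter expansion up to the stopping time `Z̄(τ)`. -/
theorem exists_finset_sum_Zbar {τ : ℝ} {N : ℕ}
    (hN : ∀ v : List (Fin (2 * S.r)), IsWord v → N < v.length → S.ups v ≤ τ)
    {V : Type*} [AddCommMonoid V] {b : Fin (2 * S.r)} (f : List (Fin (2 * S.r)) → V)
    (hf : ∀ c w, IsWord (c :: w) → (c :: w).getLast? = some b →
      f (c :: w) = ∑ a ∈ Finset.univ.filter (fun a => a ≠ wordBar c), f (a :: c :: w))
    (k : ℕ) (c : Fin (2 * S.r)) (w : List (Fin (2 * S.r))) (hw : IsWord (c :: w))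
    (hb : (c :: w).getLast? = some b) (hk : N < k + (c :: w).length)
    (h : c :: w ∈ S.Zbar τ ∨ τ < S.ups (mirror (c :: w))) :
    ∃ F : Finset (List (Fin (2 * S.r))),
      (∀ z, z ∈ F ↔ z ∈ S.Zbar τ ∧ c :: w <:+ z) ∧ f (c :: w) = ∑ z ∈ F, f z := by
  have single : ∀ c w, c :: w ∈ S.Zbar τ → ∃ F : Finset (List (Fin (2 * S.r))),
      (∀ z, z ∈ F ↔ z ∈ S.Zbar τ ∧ c :: w <:+ z) ∧ f (c :: w) = ∑ z ∈ F, f z := by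
    intro c w hmem
    refine ⟨{c :: w}, fun z => ?_, by simp⟩
    rw [Finset.mem_singleton]
    refine ⟨?_, fun ⟨hz, hwz⟩ => ?_⟩
    · rintro rfl
      exact ⟨hmem, List.suffix_rfl⟩
    · obtain ⟨t, rfl⟩ := hwz
      cases t with
      | nil => rfl
      | cons a t =>
        rw [List.cons_append, mem_Zbar_cons] at hz
        rw [mem_Zbar_cons] at hmem
        have := S.ups_mirror_le_of_suffix (List.cons_ne_nil c w) (isWord_cons.1 hz.1).2
          (List.suffix_append t _)
        linarith [hz.2.2, hmem.2.1]
  induction k generalizing c w with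
  | zero =>
    exact single c w (h.resolve_right (not_lt.2 (hN _ hw.mirror (by simpa [mirror] using hk))))
  | succ k ih =>
    by_cases hmem : c :: w ∈ S.Zbar τ
    · exact single c w hmem
    have hlt := h.resolve_left hmem
    have hstep : ∀ a, a ≠ wordBar c → ∃ F : Finset (List (Fin (2 * S.r))),
        (∀ z, z ∈ F ↔ z ∈ S.Zbar τ ∧ a :: c :: w <:+ z) ∧ f (a :: c :: w) = ∑ z ∈ F, f z := by
      intro a ha
      have hw' : IsWord (a :: c :: w) := isWord_cons.2 ⟨by simpa using ha, hw⟩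
      refine ih a (c :: w) hw' (by simpa using hb) (by simp at hk ⊢; omega) ?_
      rcases le_or_gt (S.ups (mirror (a :: c :: w))) τ with h' | h'
      · exact Or.inl (S.mem_Zbar_cons.2 ⟨hw', h', hlt⟩)
      · exact Or.inr h'
    choose! F hF hsum using hstep
    refine ⟨(Finset.univ.filter fun a => a ≠ wordBar c).biUnion F, fun z => ?_, ?_⟩
    · simp only [Finset.mem_biUnion, Finset.mem_filter, Finset.mem_univ, true_and]
      constructor
      · rintro ⟨a, ha, hz⟩
        obtain ⟨h1, h2⟩ := (hF a ha z).1 hz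
        exact ⟨h1, (List.suffix_cons a _).trans h2⟩
      · rintro ⟨hz, t, rfl⟩
        rcases List.eq_nil_or_concat' t with rfl | ⟨t, a, rfl⟩
        · exact absurd hz hmem
        · have hword : IsWord (t ++ [a] ++ c :: w) := hz.1
          have ha : a ≠ wordBar c := (isWord_append.1 hword).2.2 a (by simp) c rfl
          exact ⟨a, ha, (hF a ha _).2 ⟨hz, t, by simp⟩⟩
    · rw [hf c w hw hb, Finset.sum_biUnion]
      · exact Finset.sum_congr rfl fun a ha => hsum a (Finset.mem_filter.1 ha).2
      · intro a ha e he hae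
        refine Finset.disjoint_left.2 fun z hza hze => hae ?_
        have h1 := ((hF a (Finset.mem_filter.1 ha).2 z).1 hza).2
        have h2 := ((hF e (Finset.mem_filter.1 he).2 z).1 hze).2
        have h3 := (List.suffix_of_suffix_length_le h1 h2 (by simp)).eq_of_length (by simp)
        exact (List.cons.inj h3).1

theorem convex_Ireal (a : Fin (2 * S.r)) : Convex ℝ (S.Ireal a) := by
  rw [Ireal_eq]; exact convex_Ioo _ _

/-- The cocycle identity for complex powers of the derivative. -/
theorem mobiusDerivC_cons_cpow {a b c : Fin (2 * S.r)} {w : List (Fin (2 * S.r))}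
    (hw : IsWord (w ++ [b])) (hc : c ∈ (w ++ [b]).head?) (hac : a ≠ wordBar c) {x : ℂ}
    (hx : x ∈ S.D b) (s : ℂ) :
    mobiusDerivC (S.wprod (a :: w)) x ^ s =
      mobiusDerivC (S.g a) (mobiusC (S.wprod w) x) ^ s * mobiusDerivC (S.wprod w) x ^ s := by
  have hx' := S.ofReal_re_mem_D hx
  have hB := S.mobiusDen_wprod_ne_zero_of_mem hw hx
  have hB' := S.mobiusDen_wprod_ne_zero_of_mem hw hx'
  have hy := S.mobiusC_wprod_mem hw hx c hc
  have hy' := S.mobiusC_wprod_mem hw hx' c hc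
  have hA : ∀ t : ℝ, (t : ℂ) ∈ S.D c → (S.g a).1 1 0 * t + (S.g a).1 1 1 ≠ 0 := fun t ht =>
    mobiusDen_ofReal_ne_zero.1 (S.mobiusDen_gen_ne_zero fun h => S.disjoint_closure
      (ne_wordBar_comm.1 hac) (subset_closure ht) (subset_closure h)).1
  rw [wprod_cons]
  simp only [mobiusDerivC_eq]
  have hmul' := mobiusDen_mul (S.g a) (S.wprod w) hB'
  rw [← ofReal_mobiusR, mobiusDen_ofReal, mobiusDen_ofReal, mobiusDen_ofReal,
    ← Complex.ofReal_mul, Complex.ofReal_inj] at hmul'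
  rw [← ofReal_mobiusR] at hy'
  rw [mobiusDen_mul _ _ hB]
  refine inv_sq_mul_cpow_of_pos ?_ s
  rw [← mobiusDen_mul _ _ hB, mobiusDen_re, mobiusDen_re, mobiusDen_re, hmul']
  have hBr := mobiusDen_ofReal_ne_zero.1 hB'
  set q := (S.wprod w).1 1 0 * x.re + (S.wprod w).1 1 1
  set y := mobiusC (S.wprod w) x
  have hsign : 0 < ((S.g a).1 1 0 * y.re + (S.g a).1 1 1) *
      ((S.g a).1 1 0 * mobiusR (S.wprod w) x.re + (S.g a).1 1 1) :=
    affine_mul_pos (S.convex_Ireal c) hA (S.ofReal_re_mem_D hy) hy'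
  have : 0 < q ^ 2 := by positivity
  nlinarith [mul_pos hsign this]

end Schottky

/-- for all sufficiently small `τ > 0`, any square-integrable holomorphic
`V`-valued fixed point of the basic twisted transfer operator `ℒ_{s,ρ}` on `𝐃` is also a
fixed point of the refined transfer operator `ℒ_{τ,s,ρ}`. -/
theorem stmt_15 (S : Schottky) :
    ∃ τstar : ℝ, 0 < τstar ∧
      ∀ τ : ℝ, 0 < τ → τ < τstar →
      ∀ s : ℂ,
      ∀ (V : Type) [NormedAddCommGroup V] [InnerProductSpace ℂ V] [FiniteDimensional ℂ V],
      ∀ (ρ : S.SGroup →* (V ≃ₗᵢ[ℂ] V)) (u : ℂ → V),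
        DifferentiableOn ℂ u S.Dall →
        MeasureTheory.IntegrableOn (fun z => ‖u z‖ ^ 2) S.Dall MeasureTheory.volume →
        (∀ b : Fin (2 * S.r), ∀ x ∈ S.D b,
          u x = ∑ a ∈ Finset.univ.filter (fun a : Fin (2 * S.r) => a ≠ wordBar b),
            (mobiusDerivC (S.g a) x ^ s) • ((ρ (S.genG a)⁻¹) (u (mobiusC (S.g a) x)))) →
        (∀ b : Fin (2 * S.r), ∀ x ∈ S.D b,
          u x = ∑ᶠ w ∈ {w : List (Fin (2 * S.r)) | w ∈ S.Zbar τ ∧ w.getLast? = some b},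
            (mobiusDerivC (S.wprod w.dropLast) x ^ s) •
              ((ρ (S.wprodG w.dropLast)⁻¹) (u (mobiusC (S.wprod w.dropLast) x)))) := by
  refine ⟨1, one_pos, fun τ hτ hτ1 s V _ _ _ ρ u _ _ hu b x hx => ?_⟩
  obtain ⟨N, hN⟩ := S.exists_length_bound hτ
  set f : List (Fin (2 * S.r)) → V := fun w => (mobiusDerivC (S.wprod w.dropLast) x ^ s) •
    ((ρ (S.wprodG w.dropLast)⁻¹) (u (mobiusC (S.wprod w.dropLast) x))) with hfdef
  have hf : ∀ c w, IsWord (c :: w) → (c :: w).getLast? = some b →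
      f (c :: w) = ∑ a ∈ Finset.univ.filter (fun a => a ≠ wordBar c), f (a :: c :: w) := by
    intro c w hw hb
    obtain ⟨v, hv⟩ := List.getLast?_eq_some_iff.1 hb
    have hc : c ∈ (v ++ [b]).head? := by simp [← hv]
    rw [hv] at hw
    simp only [hfdef, List.dropLast_cons_of_ne_nil (List.cons_ne_nil c w)]
    rw [hv, List.dropLast_concat, hu c _ (S.mobiusC_wprod_mem hw hx c hc), map_sum,
      Finset.smul_sum]
    refine Finset.sum_congr rfl fun a ha => ?_
    have hG : (S.wprodG (a :: v))⁻¹ = (S.wprodG v)⁻¹ * (S.genG a)⁻¹ := by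
      rw [← mul_inv_rev]
      congr 1
    rw [S.mobiusDerivC_cons_cpow hw hc (Finset.mem_filter.1 ha).2 hx, hG, map_mul, S.wprod_cons,
      mobiusC_mul _ _ (S.mobiusDen_wprod_ne_zero_of_mem hw hx), map_smul, smul_smul, mul_comm]
    rfl
  have hb : IsWord [b] := List.isChain_singleton b
  have hroot : [b] ∈ S.Zbar τ ∨ τ < S.ups (mirror [b]) := by
    rcases le_or_gt (S.ups (mirror [b])) τ with h | h
    · exact Or.inl (S.mem_Zbar_cons.2 ⟨hb, h, by simpa [mirror, Schottky.ups] using hτ1⟩)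
    · exact Or.inr h
  obtain ⟨F, hF, hsum⟩ := S.exists_finset_sum_Zbar hN f hf N b [] hb rfl (by simp) hroot
  have hset : {w : List (Fin (2 * S.r)) | w ∈ S.Zbar τ ∧ w.getLast? = some b} = ↑F := by
    ext w
    rw [Finset.mem_coe, hF, Set.mem_ofPred_eq, List.getLast?_eq_some_iff]
    exact and_congr_right fun _ => exists_congr fun t => eq_comm
  rw [hset, finsum_mem_coe_finset, ← hsum]
  have hρ : ρ (S.wprodG [])⁻¹ = 1 := by
    rw [show S.wprodG [] = 1 from Subtype.ext S.wprod_nil, inv_one, map_one]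
  simp [hfdef, S.wprod_nil, mobiusDerivC_eq, mobiusDen_one, mobiusC_one, hρ, -map_inv]
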